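/- arXiv:1511.00742 — 9 statements merged into one kernel-verified Lean document; each statement's English description precedes it below -/
import Mathlib

section
/- Let J be a unital Jordan algebra over a field F of characteristic different from 2 and 3, and let d be a derivation with invertible values of J. Then every proper ideal I of J satisfies d(I) = 0, i.e., I ⊆ ker d. -/
/-- From Kaygorodov–Lopatin–Popov: Jordan algebras admitting derivations with invertible values. -/
theorem jordan_der_inv_values_proper_ideal_in_ker (F : Type*) [Field F] (h2 : (2 : F) ≠ 0) (h3 : (3 : F) ≠ 0)
    (J : Type*) [NonAssocRing J] [Module F J] [SMulCommClass F J J] [IsScalarTower F J J]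
    (hcomm : ∀ x y : J, x * y = y * x)
    (hjordan : ∀ x y : J, ((x * x) * y) * x = (x * x) * (y * x))
    (d : J →ₗ[F] J) (hder : ∀ a b : J, d (a * b) = d a * b + a * d b)
    (hd0 : d ≠ 0)
    (hdinv : ∀ x : J, d x = 0 ∨ ∃ y : J, d x * y = 1 ∧ (d x * d x) * y = d x)
    (I : Submodule F J) (hideal : ∀ x ∈ I, ∀ j : J, j * x ∈ I) (hproper : I ≠ ⊤) :
    ∀ x ∈ I, d x = 0 := by
  have one_not : (1 : J) ∉ I := by
    intro h1
    apply hproper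
    rw [Submodule.eq_top_iff']
    intro j
    simpa using hideal 1 h1 j
  have key : ∀ z : J, d z ∈ I → d z = 0 := by
    intro z hz
    rcases hdinv z with h | ⟨y, hy, -⟩
    · exact h
    · exfalso
      apply one_not
      rw [← hy, hcomm]
      exact hideal _ hz y
  intro x hx
  rcases hdinv x with h | ⟨y, hy1, hy2⟩
  · exact h
  exfalso
  have hax : d x * x ∈ I := hideal x hx (d x)
  -- d (x * x) = 2 (x * d x) lies in I, hence vanishes
  have e1 : d (x * x) = (2 : F) • (d x * x) := by
    rw [hder, hcomm x (d x), two_smul]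
  have e2 : d (x * x) = 0 := by
    apply key
    rw [e1]
    exact I.smul_mem _ hax
  have e3 : d x * x = 0 := by
    rw [e1] at e2
    exact (smul_eq_zero.mp e2).resolve_left h2
  -- differentiate once more: (d x)^2 = - d (d x) * x lies in I
  have e4 : d (d x) * x + d x * d x = 0 := by
    rw [← hder, e3, map_zero]
  have e5 : d x * d x ∈ I := by
    rw [eq_neg_of_add_eq_zero_right e4]
    exact I.neg_mem (hideal x hx _)
  have e6 : d x ∈ I := by
    have := hideal _ e5 y
    rwa [hcomm, hy2] at this
  apply one_not
  rw [← hy1, hcomm]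
  exact hideal _ e6 y
end

section
/- Let J be a unital Jordan algebra over a field F of characteristic different from 2 and 3, let d be a derivation with invertible values of J, and let I be an ideal of J with I ⊆ ker d. Then I² = 0, that is, a b = 0 for all a, b in I. -/
/-- From Kaygorodov–Lopatin–Popov: Jordan algebras admitting derivations with invertible values. -/
theorem jordan_der_inv_values_ideal_in_ker_square_zero (F : Type*) [Field F] (h2 : (2 : F) ≠ 0) (h3 : (3 : F) ≠ 0)
    (J : Type*) [NonAssocRing J] [Module F J] [SMulCommClass F J J] [IsScalarTower F J J]
    (hcomm : ∀ x y : J, x * y = y * x)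
    (hjordan : ∀ x y : J, ((x * x) * y) * x = (x * x) * (y * x))
    (d : J →ₗ[F] J) (hder : ∀ a b : J, d (a * b) = d a * b + a * d b)
    (hd0 : d ≠ 0)
    (hdinv : ∀ x : J, d x = 0 ∨ ∃ y : J, d x * y = 1 ∧ (d x * d x) * y = d x)
    (I : Submodule F J) (hideal : ∀ x ∈ I, ∀ j : J, j * x ∈ I)
    (hker : ∀ x ∈ I, d x = 0) :
    ∀ a ∈ I, ∀ b ∈ I, a * b = 0 := by
  have key : ∀ x y z t : J, ((x * z) * y) * t + z * (y * (x * t)) + x * (y * (z * t))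
      = (x * z) * (y * t) + (y * z) * (x * t) + (x * y) * (z * t) := by
    intro x y z t
    have e1 := hjordan (x + z + t) y
    have e2 := hjordan (x + z) y
    have e3 := hjordan (x + t) y
    have e4 := hjordan (z + t) y
    have e5 := hjordan x y
    have e6 := hjordan z y
    have e7 := hjordan t y
    simp only [mul_add, add_mul] at e1 e2 e3 e4
    rw [hcomm z x, hcomm t x, hcomm t z] at e1
    rw [hcomm z x] at e2
    rw [hcomm t x] at e3
    rw [hcomm t z] at e4
    rw [hcomm z (y * (x * t)), hcomm y (x * t), hcomm x (y * (z * t)), hcomm y (z * t),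
      hcomm (y * z) (x * t), hcomm (x * y) (z * t), hcomm x y]
    rw [← sub_eq_zero]
    have h : (2 : F) • ((x * z * y * t + x * t * y * z + z * t * y * x) -
        (x * z * (y * t) + x * t * (y * z) + z * t * (y * x))) = 0 := by
      rw [two_smul]
      rw [← sub_eq_zero] at e1 e2 e3 e4 e5 e6 e7
      have e := congrArg₂ (· - ·) (congrArg₂ (· + ·) e1 (congrArg₂ (· + ·) e5 (congrArg₂ (· + ·) e6 e7)))
        (congrArg₂ (· + ·) e2 (congrArg₂ (· + ·) e3 e4))
      simp only [add_zero, sub_zero] at e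
      rw [← e]
      abel
    exact (smul_eq_zero.mp h).resolve_left h2
  obtain ⟨x, hx⟩ : ∃ x, d x ≠ 0 := by
    by_contra hcon
    push Not at hcon
    exact hd0 (LinearMap.ext hcon)
  obtain ⟨y, hy1, hy2⟩ := (hdinv x).resolve_left hx
  have hu : ∀ a ∈ I, d x * a = 0 := by
    intro a ha
    have h := hder x a
    rw [hker _ (hideal a ha x), hker a ha, mul_zero, add_zero] at h
    exact h.symm
  generalize d x = u at hy1 hy2 hu
  have huy : ∀ a ∈ I, (u * u) * (y * a) = 0 := by
    intro a ha
    have h := key u y u a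
    rw [hy2, hcomm y u, hy1, hu a ha] at h
    simpa using h.symm
  intro a ha b hb
  have hw : a * b ∈ I := hideal b hb a
  have h0 : (u * u) * (a * b) = 0 := by
    have h := key a u u b
    rw [hcomm a u, hu a ha, hu b hb, hu _ hw] at h
    simpa using h.symm
  have h := key (u * u) y y (a * b)
  rw [hy2, hy1, h0, huy _ (hideal _ hw y), hu _ (hideal _ hw y)] at h
  simpa using h
end

section
/- Let J be a unital Jordan algebra over a field F of characteristic different from 2 and 3, let d be a derivation with invertible values of J, and let M be the sum (supremum as F-subspaces) of all ideals of J contained in ker d. Then M is a proper ideal of J, M ⊆ ker d, a b = 0 for all a, b in M, and every proper ideal of J is contained in M (so M is the largest proper ideal of J, and the quotient J/M is simple). -/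
theorem jordan_lin_aux (F : Type*) [Field F] (h2 : (2 : F) ≠ 0)
    (J : Type*) [NonAssocRing J] [Module F J]
    (hcomm : ∀ x y : J, x * y = y * x)
    (hjordan : ∀ x y : J, ((x * x) * y) * x = (x * x) * (y * x)) (x y z w : J) :
    (x * y) * (z * w) + (y * z) * (x * w) + (z * x) * (y * w) =
      z * ((x * y) * w) + x * ((y * z) * w) + y * ((z * x) * w) := by
  let _ : NonUnitalNonAssocCommRing J := { ‹NonAssocRing J› with mul_comm := hcomm }
  have _ : IsCommJordan J := ⟨fun a b => by
    rw [hcomm (a * b) (a * a), hcomm a b, ← hjordan, hcomm _ a, hcomm (a * a) b]⟩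
  have h := two_nsmul_lie_lmul_lmul_add_add_eq_zero x y z
  have h' := congrArg (fun f : AddMonoid.End J => f w) h
  simp only [two_nsmul, Ring.lie_def] at h'
  have key : (2 : F) • (x * ((y * z) * w) - (y * z) * (x * w)
      + (y * ((z * x) * w) - (z * x) * (y * w))
      + (z * ((x * y) * w) - (x * y) * (z * w))) = 0 := by
    rw [two_smul]
    exact h'
  have k := (smul_eq_zero.mp key).resolve_left h2
  rw [← sub_eq_zero, ← neg_eq_zero, ← k]
  abel

/-- From Kaygorodov–Lopatin–Popov: Jordan algebras admitting derivations with invertible values. -/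
theorem jordan_der_inv_values_largest_ideal (F : Type*) [Field F] (h2 : (2 : F) ≠ 0) (h3 : (3 : F) ≠ 0)
    (J : Type*) [NonAssocRing J] [Module F J] [SMulCommClass F J J] [IsScalarTower F J J]
    (hcomm : ∀ x y : J, x * y = y * x)
    (hjordan : ∀ x y : J, ((x * x) * y) * x = (x * x) * (y * x))
    (d : J →ₗ[F] J) (hder : ∀ a b : J, d (a * b) = d a * b + a * d b)
    (hd0 : d ≠ 0)
    (hdinv : ∀ x : J, d x = 0 ∨ ∃ y : J, d x * y = 1 ∧ (d x * d x) * y = d x)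
    (M : Submodule F J)
    (hM : M = sSup {I : Submodule F J |
      (∀ x ∈ I, ∀ j : J, j * x ∈ I) ∧ ∀ x ∈ I, d x = 0}) :
    (∀ x ∈ M, ∀ j : J, j * x ∈ M) ∧ M ≠ ⊤ ∧ (∀ x ∈ M, d x = 0) ∧
      (∀ a ∈ M, ∀ b ∈ M, a * b = 0) ∧
      ∀ I : Submodule F J, (∀ x ∈ I, ∀ j : J, j * x ∈ I) → I ≠ ⊤ → I ≤ M := by
  have H := jordan_lin_aux F h2 J hcomm hjordan
  have hd1 : d 1 = 0 := by
    have := hder 1 1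
    simpa using this
  -- an ideal containing an invertible element is everything
  have htop : ∀ I : Submodule F J, (∀ x ∈ I, ∀ j : J, j * x ∈ I) → I ≠ ⊤ →
      ∀ x ∈ I, d x ∈ I → d x = 0 := by
    intro I hI hne x _ hdx
    rcases hdinv x with h | ⟨y, hy, _⟩
    · exact h
    · exfalso
      apply hne
      rw [eq_top_iff]
      intro j _
      have h1 : (1 : J) ∈ I := by
        rw [← hy, hcomm]; exact hI _ hdx y
      simpa using hI 1 h1 j
  have hprop : ∀ I : Submodule F J, (∀ x ∈ I, ∀ j : J, j * x ∈ I) → I ≠ ⊤ →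
      ∀ x ∈ I, d x = 0 := by
    intro I hI hne x hx
    apply htop I hI hne x hx
    have e1 : d (x * x) = (2 : F) • (d x * x) := by
      rw [hder, two_smul, hcomm x (d x)]
    have e2 : d (x * x) = 0 := by
      apply htop I hI hne _ (hI x hx x)
      rw [e1]; exact I.smul_mem _ (hI x hx _)
    have e3 : d x * x = 0 := (smul_eq_zero.mp (e1 ▸ e2)).resolve_left h2
    have e4 : d (d x) * x + d x * d x = 0 := by rw [← hder, e3, map_zero]
    have e5 : d x * d x ∈ I := by
      rw [eq_neg_of_add_eq_zero_right e4]
      exact I.neg_mem (hI x hx _)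
    rcases hdinv x with h | ⟨y, _, hy⟩
    · rw [h]; exact I.zero_mem
    · rw [← hy, hcomm]; exact hI _ e5 y
  have hMker : ∀ x ∈ M, d x = 0 := by
    have : M ≤ LinearMap.ker d := by
      rw [hM]
      exact sSup_le fun I hI x hx => LinearMap.mem_ker.mpr (hI.2 x hx)
    exact fun x hx => LinearMap.mem_ker.mp (this hx)
  have hMid : ∀ x ∈ M, ∀ j : J, j * x ∈ M := by
    intro x hx j
    have : M ≤ M.comap (LinearMap.mulLeft F j) := by
      conv_lhs => rw [hM]
      refine sSup_le fun I hI x hx => ?_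
      rw [Submodule.mem_comap, hM]
      exact (le_sSup hI : I ≤ _) (hI.1 x hx j)
    exact this hx
  obtain ⟨j, hj⟩ : ∃ j, d j ≠ 0 := by
    by_contra hcon
    push Not at hcon
    exact hd0 (LinearMap.ext hcon)
  refine ⟨hMid, ?_, hMker, ?_, ?_⟩
  · rintro rfl
    exact hj (hMker j Submodule.mem_top)
  · obtain ⟨y, hy1, hy2⟩ := (hdinv j).resolve_left hj
    have hc : ∀ m ∈ M, d j * m = 0 := by
      intro m hm
      have := hMker _ (hMid m hm j)
      rwa [hder, hMker m hm, mul_zero, add_zero] at this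
    generalize d j = c at hy1 hy2 hc
    have hcomm1 : ∀ m ∈ M, (c * c) * (y * m) = y * ((c * c) * m) := by
      intro m hm
      have := H c c y m
      simp only [hy1, hcomm y c, hc m hm, one_mul, mul_zero, add_zero] at this
      exact this
    have hinj : ∀ m ∈ M, (c * c) * m = 0 → m = 0 := by
      intro m hm h0
      have t := H m y (c * c) y
      have hym := hMid m hm y
      rw [hcomm m y, hcomm y (c * c), hy2, h0, hy1, hcomm (y * m) y, hcomm _ y,
        hcomm1 _ hym, hcomm1 _ hm, h0, hcomm _ c, hc _ hym] at t
      simpa using t.symm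
    intro a ha b hb
    apply hinj _ (hMid b hb a)
    have t := H a b c c
    have hab := hMid b hb a
    rw [hcomm b c, hc b hb, hcomm a c, hc a ha, hcomm (a * b) c, hc _ hab] at t
    rw [hcomm]
    simpa using t
  · intro I hI hne
    rw [hM]
    exact le_sSup ⟨hI, hprop I hI hne⟩
end

section
/- Let F be a field of characteristic different from 2 and 3, V an F-vector space, and f a symmetric bilinear form on V. There exists a nonzero F-linear endomorphism φ of V satisfying conditions (1) and (2) (equivalently, the Jordan algebra J(V,f) admits a derivation with invertible values) if and only if there exist x, y in V with f(x,x) ≠ 0, f(y,y) ≠ 0, f(x,y) = 0, and −f(y,y)/f(x,x) is not a square in F (i.e., α² f(x,x) ≠ −f(y,y) for every α in F). -/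
/-- The Jordan algebra J(V,f) of a symmetric bilinear form admits a derivation with
invertible values (a nonzero endomorphism φ with f(v,φv)=0 and f(φv,φv)=0 → φv=0)
iff there are x, y with f(x,x) ≠ 0, f(y,y) ≠ 0, f(x,y) = 0 and -f(y,y)/f(x,x) not a square. -/
theorem bilinear_form_der_inv_values_iff (F : Type*) [Field F]
    (h2 : (2 : F) ≠ 0) (h3 : (3 : F) ≠ 0)
    (V : Type*) [AddCommGroup V] [Module F V]
    (f : V →ₗ[F] V →ₗ[F] F) (hsymm : ∀ u v : V, f u v = f v u) :
    (∃ φ : V →ₗ[F] V, φ ≠ 0 ∧ (∀ v : V, f v (φ v) = 0) ∧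
        ∀ v : V, f (φ v) (φ v) = 0 → φ v = 0) ↔
      ∃ x y : V, f x x ≠ 0 ∧ f y y ≠ 0 ∧ f x y = 0 ∧
        ∀ α : F, α ^ 2 * f x x ≠ -(f y y) := by
  constructor
  · rintro ⟨φ, hφ, h1, hinv⟩
    obtain ⟨v, hv⟩ : ∃ v, φ v ≠ 0 := by
      by_contra hcon
      push Not at hcon
      exact hφ (LinearMap.ext hcon)
    have hu : f (φ v) (φ v) ≠ 0 := fun h => hv (hinv v h)
    have hy : φ (φ v) ≠ 0 := by
      intro h
      have e := h1 (v + φ v)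
      have e1 := h1 v
      simp only [map_add, LinearMap.add_apply, h, map_zero, add_zero, e1, zero_add] at e
      exact hu e
    have hyy : f (φ (φ v)) (φ (φ v)) ≠ 0 := fun h => hy (hinv _ h)
    have hxy := h1 (φ v)
    refine ⟨φ v, φ (φ v), hu, hyy, hxy, fun α hα => ?_⟩
    have hs := hsymm (φ (φ v)) (φ v)
    have hz : φ (α • v + φ v) = 0 := by
      apply hinv
      simp only [map_add, map_smul, LinearMap.add_apply, LinearMap.smul_apply, smul_eq_mul, hs, hxy]
      linear_combination hα
    have hα0 : α * f (φ v) (φ v) = 0 := by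
      have := congrArg (f (φ v)) hz
      simpa only [map_add, map_smul, smul_eq_mul, hxy, add_zero, map_zero] using this
    have : α = 0 := (mul_eq_zero.mp hα0).resolve_right hu
    subst this
    apply hyy
    linear_combination hα
  · rintro ⟨x, y, hx, hy, hxy, hα⟩
    have hyx : f y x = 0 := by rw [hsymm, hxy]
    refine ⟨(f x).smulRight y - (f y).smulRight x, ?_, ?_, ?_⟩
    · intro h
      have h' := congrArg (f y) (LinearMap.congr_fun h x)
      simp [hyx] at h'
      exact h'.elim hx hy
    · intro v
      simp only [LinearMap.sub_apply, LinearMap.smulRight_apply, map_sub, map_smul, smul_eq_mul,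
        hsymm v x, hsymm v y]
      ring
    · intro v hv
      simp only [LinearMap.sub_apply, LinearMap.smulRight_apply, map_sub, map_smul, smul_eq_mul,
        LinearMap.smul_apply, hxy, hyx] at hv ⊢
      have ha : f x v = 0 := by
        by_contra ha
        apply hα (f y v / f x v)
        field_simp
        linear_combination hv
      have hb : f y v = 0 := by
        rw [ha] at hv
        have : f y v * (f y v * f x x) = 0 := by linear_combination hv
        simpa [hx] using this
      simp [ha, hb]
end

section
/- Let F be a field of characteristic different from 2 and 3, V an F-vector space, f a symmetric bilinear form on V, and φ a nonzero F-linear endomorphism of V satisfying conditions (1) and (2). Then the image of φ is not contained in a one-dimensional subspace: there exist v, w in V such that φ(v) and φ(w) are linearly independent over F. -/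
/-- A nonzero endomorphism φ with f(v,φv)=0 and (f(φv,φv)=0 → φv=0) has image not
contained in a one-dimensional subspace: some two values of φ are linearly independent. -/
theorem bilinear_form_der_inv_values_image_not_one_dim (F : Type*) [Field F]
    (h2 : (2 : F) ≠ 0) (h3 : (3 : F) ≠ 0)
    (V : Type*) [AddCommGroup V] [Module F V]
    (f : V →ₗ[F] V →ₗ[F] F) (hsymm : ∀ u v : V, f u v = f v u)
    (φ : V →ₗ[F] V) (hφ0 : φ ≠ 0)
    (h1 : ∀ v : V, f v (φ v) = 0)
    (hinv : ∀ v : V, f (φ v) (φ v) = 0 → φ v = 0) :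
    ∃ v w : V, LinearIndependent F ![φ v, φ w] := by
  obtain ⟨v, hv⟩ : ∃ v, φ v ≠ 0 := by
    by_contra h
    push Not at h
    exact hφ0 (LinearMap.ext h)
  have hn : f (φ v) (φ v) ≠ 0 := fun h => hv (hinv v h)
  have hp : f v (φ (φ v)) + f (φ v) (φ v) = 0 := by
    have h := h1 (v + φ v)
    simp only [map_add, LinearMap.add_apply, h1] at h
    simpa [add_comm] using h
  have hm : f v (φ (φ v)) ≠ 0 := by
    intro h
    rw [h, zero_add] at hp
    exact hn hp
  refine ⟨v, φ v, LinearIndependent.pair_iff.mpr ?_⟩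
  intro s t hst
  have ht : t = 0 := by
    have h := congrArg (f v) hst
    simp only [map_add, map_smul, h1, smul_eq_mul, mul_zero, zero_add, map_zero] at h
    exact (mul_eq_zero.mp h).resolve_right hm
  subst ht
  rw [zero_smul, add_zero] at hst
  exact ⟨(smul_eq_zero.mp hst).resolve_right hv, rfl⟩
end

section
/- Let F be a field of characteristic different from 2 and 3, V an F-vector space, and f a symmetric bilinear form on V. Suppose x, y in V satisfy f(x,x) ≠ 0, f(y,y) ≠ 0, f(x,y) = 0, and α² f(x,x) ≠ −f(y,y) for every α in F (i.e., −f(y,y)/f(x,x) is not a square in F). Then the F-linear map φ : V → V defined by φ(v) = (f(x,v)/f(x,x))·y − (f(y,v)/f(x,x))·x is nonzero (indeed φ(x) = y) and satisfies conditions (1) and (2). -/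
/-- Given x, y with f(x,x) ≠ 0, f(y,y) ≠ 0, f(x,y) = 0 and -f(y,y)/f(x,x) not a square,
the linear map φ(v) = (f(x,v)/f(x,x))·y - (f(y,v)/f(x,x))·x is nonzero (φ(x) = y) and
satisfies conditions (1) and (2). -/
theorem bilinear_form_explicit_der_inv_values (F : Type*) [Field F]
    (h2 : (2 : F) ≠ 0) (h3 : (3 : F) ≠ 0)
    (V : Type*) [AddCommGroup V] [Module F V]
    (f : V →ₗ[F] V →ₗ[F] F) (hsymm : ∀ u v : V, f u v = f v u)
    (x y : V) (hx : f x x ≠ 0) (hy : f y y ≠ 0) (hxy : f x y = 0)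
    (hsq : ∀ α : F, α ^ 2 * f x x ≠ -(f y y))
    (φ : V →ₗ[F] V)
    (hφ : ∀ v : V, φ v = (f x v / f x x) • y - (f y v / f x x) • x) :
    φ x = y ∧ φ ≠ 0 ∧ (∀ v : V, f v (φ v) = 0) ∧
      ∀ v : V, f (φ v) (φ v) = 0 → φ v = 0 := by
  have hyx : f y x = 0 := by rw [hsymm, hxy]
  have h1 : φ x = y := by rw [hφ, hyx, div_self hx]; simp
  refine ⟨h1, ?_, ?_, ?_⟩
  · rintro rfl
    apply hy
    rw [← h1]
    simp
  · intro v
    rw [hφ, map_sub, map_smul, map_smul, hsymm v x, hsymm v y, smul_eq_mul, smul_eq_mul]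
    ring
  · intro v hv
    rw [hφ] at hv ⊢
    generalize f x v / f x x = a at *
    generalize f y v / f x x = b at *
    simp only [map_sub, map_smul, LinearMap.sub_apply, LinearMap.smul_apply, smul_eq_mul,
      hxy, hyx] at hv
    have key : a ^ 2 * f y y + b ^ 2 * f x x = 0 := by linear_combination hv
    by_cases ha : a = 0
    · subst ha
      have hb : b = 0 := by simpa [hx] using key
      simp [hb]
    · exfalso
      apply hsq (b / a)
      field_simp
      linear_combination key
end

section
/- Let F be an algebraically closed field of characteristic different from 2 and 3, V an F-vector space, and f a symmetric bilinear form on V. Then there is no nonzero F-linear endomorphism φ of V satisfying conditions (1) and (2); equivalently, the Jordan algebra J(V,f) of the symmetric bilinear form f admits no derivation with invertible values. -/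
/-- Over an algebraically closed field of characteristic ≠ 2, 3, the Jordan algebra of a
symmetric bilinear form admits no derivation with invertible values: there is no nonzero
endomorphism φ with f(v,φv)=0 and (f(φv,φv)=0 → φv=0). -/
theorem bilinear_form_no_der_inv_values_alg_closed (F : Type*) [Field F] [IsAlgClosed F]
    (h2 : (2 : F) ≠ 0) (h3 : (3 : F) ≠ 0)
    (V : Type*) [AddCommGroup V] [Module F V]
    (f : V →ₗ[F] V →ₗ[F] F) (hsymm : ∀ u v : V, f u v = f v u) :
    ¬ ∃ φ : V →ₗ[F] V, φ ≠ 0 ∧ (∀ v : V, f v (φ v) = 0) ∧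
        ∀ v : V, f (φ v) (φ v) = 0 → φ v = 0 := by
  rintro ⟨φ, hne, h1, hinv⟩
  apply hne
  ext v
  simp only [LinearMap.zero_apply]
  by_contra hw
  have hww : f (φ v) (φ v) ≠ 0 := fun h => hw (hinv v h)
  have h0 : φ (φ v) = 0 := by
    by_contra hu
    have huu : f (φ (φ v)) (φ (φ v)) ≠ 0 := fun h => hu (hinv _ h)
    obtain ⟨t, ht⟩ := IsAlgClosed.exists_pow_nat_eq
      (-(f (φ v) (φ v)) / f (φ (φ v)) (φ (φ v))) (n := 2) (by norm_num)
    have ht' : t ^ 2 * f (φ (φ v)) (φ (φ v)) = -(f (φ v) (φ v)) := by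
      rw [ht, div_mul_cancel₀ _ huu]
    have ho := h1 (φ v)
    have ho' : f (φ (φ v)) (φ v) = 0 := by rw [hsymm]; exact ho
    have key := hinv (v + t • φ v) (by
      simp only [map_add, map_smul, LinearMap.add_apply, LinearMap.smul_apply, smul_eq_mul, ho, ho']
      linear_combination ht')
    have := congrArg (f (φ v)) key
    simp only [map_add, map_smul, smul_eq_mul, ho, map_zero, mul_zero, add_zero] at this
    exact hww this
  have h := h1 (v + φ v)
  simp only [map_add, LinearMap.add_apply, h0, h1 v, map_zero, add_zero, zero_add] at h
  exact hww h
end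

section
/- Let F be a field of characteristic different from 2 and 3, and let A be a unital associative F-algebra that is simple (its only two-sided ideals are 0 and A). Suppose there is a nonzero F-linear map d : A → A satisfying d(a ∘ b) = d(a) ∘ b + a ∘ d(b) for all a, b in A, where a ∘ b = (a b + b a)/2 is the multiplication of the symmetrized algebra A^(+), such that for every a in A the element d(a) is either 0 or invertible in A. Then either A is a division ring, or there exists a division ring D such that A is isomorphic as a ring to the algebra of 2 × 2 matrices over D. -/
universe u

section aux
variable {A : Type u} [Ring A]

theorem aux_prime (hsimple : ∀ I : TwoSidedIdeal A, I = ⊥ ∨ I = ⊤) (a b : A)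
    (h : ∀ r, a * r * b = 0) : a = 0 ∨ b = 0 := by
  let I : TwoSidedIdeal A := TwoSidedIdeal.mk' {x | ∀ r, x * r * b = 0}
    (by intro r; simp)
    (by intro x y hx hy r; simp only [Set.mem_ofPred_eq] at hx hy; rw [add_mul, add_mul, hx, hy, add_zero])
    (by intro x hx r; simp only [Set.mem_ofPred_eq] at hx; rw [neg_mul, neg_mul, hx, neg_zero])
    (by intro x y hy r; simp only [Set.mem_ofPred_eq] at hy; rw [mul_assoc x, mul_assoc x, hy, mul_zero])
    (by intro x y hx r; simp only [Set.mem_ofPred_eq] at hx; rw [mul_assoc x, hx])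
  have hI : ∀ x, x ∈ I ↔ ∀ r, x * r * b = 0 := fun x => TwoSidedIdeal.mem_mk' _ _ _ _ _ _ _
  rcases hsimple I with h0 | h1
  · left
    have : a ∈ I := (hI a).2 h
    rw [h0] at this
    exact (TwoSidedIdeal.mem_bot A).1 this
  · right
    have : (1 : A) ∈ I := by rw [h1]; trivial
    simpa using (hI 1).1 this 1

theorem aux_herstein (htor : ∀ x : A, x + x = 0 → x = 0)
    (hprime : ∀ a b : A, (∀ r, a * r * b = 0) → a = 0 ∨ b = 0)
    (d : A →+ A)
    (J : ∀ a b, d (a * b + b * a) = d a * b + b * d a + a * d b + d b * a) (a b : A) :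
    d (a * b) = d a * b + a * d b := by
  have sq : ∀ a, d (a * a) = d a * a + a * d a := by
    intro a
    have h := J a a
    rw [map_add] at h
    rw [← sub_eq_zero]
    apply htor
    rw [← sub_eq_zero] at h
    rw [← h]; abel
  have tri : ∀ a b, d (a * b * a) = d a * b * a + a * d b * a + a * b * d a := by
    intro a b
    have h1 := J a (a * b + b * a)
    have h2 := J (a * a) b
    rw [J a b, show a * (a * b + b * a) + (a * b + b * a) * a =
      (a * a * b + b * (a * a)) + (a * b * a + a * b * a) by noncomm_ring, map_add, h2, sq,
      map_add] at h1
    rw [← sub_eq_zero]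
    apply htor
    rw [← sub_eq_zero] at h1
    rw [← h1]; noncomm_ring
  have tri2 : ∀ a b c, d (a * b * c + c * b * a) = d a * b * c + a * d b * c + a * b * d c
      + (d c * b * a + c * d b * a + c * b * d a) := by
    intro a b c
    have h1 := tri (a + c) b
    rw [show (a + c) * b * (a + c) = a * b * a + c * b * c + (a * b * c + c * b * a) by
      noncomm_ring, map_add, map_add, map_add, tri, tri, map_add d a c] at h1
    rw [map_add]
    rw [← sub_eq_zero] at h1 ⊢
    rw [← h1]; noncomm_ring
  let φ : A → A → A := fun a b => d (a * b) - d a * b - a * d b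
  have key : ∀ a b x, φ a b * x * (a * b - b * a) + (a * b - b * a) * x * φ a b = 0 := by
    intro a b x
    have h1 := tri2 (a * b) x (b * a)
    have h2 := tri a (b * x * b)
    have h3 := tri b (a * x * a)
    rw [tri b x] at h2
    rw [tri a x] at h3
    have h4 : d (b * a) = d a * b + b * d a + a * d b + d b * a - d (a * b) := by
      rw [← J, map_add]; abel
    rw [show a * b * x * (b * a) + b * a * x * (a * b) =
      a * (b * x * b) * a + b * (a * x * a) * b by noncomm_ring, map_add, h2, h3, h4] at h1
    rw [← sub_eq_zero] at h1
    simp only [φ]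
    rw [← h1]; noncomm_ring
  have pq : ∀ p q : A, (∀ x, p * x * q + q * x * p = 0) → p = 0 ∨ q = 0 := by
    intro p q h
    apply hprime
    intro x
    have : ∀ y, p * x * q * y * (p * x * q) = 0 := by
      intro y
      apply htor
      have e1 := h y
      have e2 := h x
      have e3 := h (x * p * y)
      have : p * x * q * y * (p * x * q) + p * x * q * y * (p * x * q) =
        p * x * (p * y * q + q * y * p) * x * q + (p * x * q + q * x * p) * y * p * x * q
        - (p * (x * p * y) * q + q * (x * p * y) * p) * x * q := by noncomm_ring
      rw [this, e1, e2, e3]; simp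
    rcases hprime _ _ this with h | h <;> exact h
  have alt : ∀ a b, φ a b = 0 ∨ a * b - b * a = 0 := fun a b => pq _ _ (key a b)
  have φr : ∀ a b c, φ a (b + c) = φ a b + φ a c := by
    intro a b c; simp only [φ, mul_add, map_add]; abel
  have φl : ∀ a b c, φ (a + b) c = φ a c + φ b c := by
    intro a b c; simp only [φ, add_mul, map_add]; abel
  have alt1 : ∀ a, (∀ b, φ a b = 0) ∨ (∀ b, a * b - b * a = 0) := by
    intro a
    by_contra! hc
    obtain ⟨⟨b, hb⟩, c, hc⟩ := hc
    have hb' := (alt a b).resolve_left hb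
    have hc' := (alt a c).resolve_right hc
    rcases alt a (b + c) with h | h
    · rw [φr, hc', add_zero] at h; exact hb h
    · apply hc
      rw [show a * c - c * a = (a * (b + c) - (b + c) * a) - (a * b - b * a) by noncomm_ring,
        h, hb', sub_zero]
  have alt2 : (∀ a b, φ a b = 0) ∨ (∀ a b : A, a * b - b * a = 0) := by
    by_contra! hc
    obtain ⟨⟨a, b, hab⟩, c, e, hce⟩ := hc
    have ha := (alt1 a).resolve_left (fun h => hab (h b))
    have hc' := (alt1 c).resolve_right (fun h => hce (h e))
    rcases alt1 (a + c) with h | h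
    · have := h b
      rw [φl, hc', add_zero] at this; exact hab this
    · apply hce
      have h1 := h e
      have h2 := ha e
      rw [show c * e - e * c = ((a + c) * e - e * (a + c)) - (a * e - e * a) by noncomm_ring,
        h1, h2, sub_zero]
  rcases alt2 with h | h
  · have := h a b
    simp only [φ] at this
    rw [← sub_eq_zero, ← this]; abel
  · have h1 := J a b
    have c1 := sub_eq_zero.1 (h a b)
    have c2 := sub_eq_zero.1 (h (d a) b)
    have c3 := sub_eq_zero.1 (h a (d b))
    rw [← c1, ← c2, ← c3, map_add] at h1
    rw [← sub_eq_zero]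
    apply htor
    rw [← sub_eq_zero] at h1
    rw [← h1]; abel

theorem aux_chain (d : A →+ A) (hd : ∀ a b, d (a * b) = d a * b + a * d b)
    (hd0 : ∃ b, d b ≠ 0) (hdinv : ∀ a : A, d a = 0 ∨ IsUnit (d a))
    (L' L : Submodule A A) (h0 : L' ≠ ⊥) (hle : L' ≤ L) (hL : L ≠ ⊤) : L' = L := by
  have ker : ∀ a, d a = 0 → a = 0 ∨ IsUnit a := by
    intro a ha
    obtain ⟨b, hb⟩ := hd0
    have ub := (hdinv b).resolve_left hb
    have h := hdinv (a * b)
    rw [hd, ha, zero_mul, zero_add] at h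
    rcases h with h | h
    · left; exact (ub.mul_left_eq_zero).1 h
    · right
      obtain ⟨u, hu⟩ := ub
      rw [← hu] at h
      exact (Units.isUnit_mul_units a u).1 h
  have nu : ∀ a ∈ L, ¬ IsUnit a := fun a ha hu => hL (Ideal.eq_top_of_isUnit_mem L ha hu)
  obtain ⟨a, haL', ha0⟩ := Submodule.exists_mem_ne_zero_of_ne_bot h0
  have uda : IsUnit (d a) := by
    refine (hdinv a).resolve_left fun h => ?_
    rcases ker a h with h | h
    · exact ha0 h
    · exact nu a (hle haL') h
  obtain ⟨u, hu⟩ := uda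
  refine le_antisymm hle fun b hb => ?_
  -- write `d b = x * d a`
  let x := d b * ((u⁻¹ : Aˣ) : A)
  have hx : d b = x * d a := by rw [← hu]; simp [x]
  have hv : x * a ∈ L' := L'.smul_mem x haL'
  have hw : d (b - x * a) = - (d x * a) := by rw [map_sub, hd, hx]; abel
  have hw' : d (b - x * a) ∈ L := by
    rw [hw]; exact L.neg_mem (hle (L'.smul_mem (d x) haL'))
  have hz : d (b - x * a) = 0 := (hdinv _).resolve_right (nu _ hw')
  have hm : b - x * a ∈ L := L.sub_mem hb (hle hv)
  have := (ker _ hz).resolve_right (nu _ hm)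
  rw [sub_eq_zero.1 this]; exact hv

theorem aux_artinian
    (hc : ∀ L' L : Submodule A A, L' ≠ ⊥ → L' ≤ L → L ≠ ⊤ → L' = L) : IsArtinianRing A := by
  have a0 : Acc (· < ·) (⊥ : Submodule A A) := ⟨_, fun y hy => absurd hy not_lt_bot⟩
  have a1 : ∀ L : Submodule A A, L ≠ ⊤ → Acc (· < ·) L := by
    intro L hL
    refine ⟨_, fun y hy => ?_⟩
    by_cases h : y = ⊥
    · rw [h]; exact a0
    · exact absurd (hc y L h hy.le hL) hy.ne
  have : WellFoundedLT (Submodule A A) := by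
    refine ⟨⟨fun L => ⟨_, fun y hy => a1 y ?_⟩⟩⟩
    exact (lt_of_lt_of_le hy le_top).ne
  exact this

end aux

/-- If a simple unital associative algebra A over a field of characteristic ≠ 2, 3 admits a
derivation with invertible values of the symmetrized Jordan algebra A⁺ (with product
a ∘ b = (ab + ba)/2), then A is a division ring or a 2×2 matrix ring over a division ring. -/
theorem symmetrized_simple_assoc_der_inv_values (F : Type*) [Field F]
    (h2 : (2 : F) ≠ 0) (h3 : (3 : F) ≠ 0)
    (A : Type u) [Ring A] [Algebra F A]
    (hsimple : ∀ I : TwoSidedIdeal A, I = ⊥ ∨ I = ⊤)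
    (d : A →ₗ[F] A)
    (hder : ∀ a b : A, d ((2 : F)⁻¹ • (a * b + b * a)) =
      (2 : F)⁻¹ • (d a * b + b * d a) + (2 : F)⁻¹ • (a * d b + d b * a))
    (hd0 : d ≠ 0)
    (hdinv : ∀ a : A, d a = 0 ∨ IsUnit (d a)) :
    (Nontrivial A ∧ ∀ a : A, a ≠ 0 → IsUnit a) ∨
      ∃ (D : Type u) (_ : DivisionRing D), Nonempty (A ≃+* Matrix (Fin 2) (Fin 2) D) := by
  have hnt : Nontrivial A := by
    by_contra h
    rw [not_nontrivial_iff_subsingleton] at h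
    exact hd0 (LinearMap.ext fun x => Subsingleton.elim _ _)
  have htor : ∀ x : A, x + x = 0 → x = 0 := by
    intro x hx
    have : (2 : F) • x = 0 := by rw [two_smul, hx]
    exact (smul_eq_zero.1 this).resolve_left h2
  have J : ∀ a b, d (a * b + b * a) = d a * b + b * d a + a * d b + d b * a := by
    intro a b
    have h := hder a b
    rw [map_smul, ← smul_add] at h
    rw [smul_right_injective A (inv_ne_zero h2) h]; abel
  have hd := aux_herstein htor (aux_prime hsimple) d.toAddMonoidHom J
  have hd0' : ∃ b, d.toAddMonoidHom b ≠ 0 := by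
    by_contra! h
    exact hd0 (LinearMap.ext h)
  have hc := aux_chain d.toAddMonoidHom hd hd0' hdinv
  have : IsArtinianRing A := aux_artinian hc
  have : IsSimpleRing A := ⟨⟨hsimple⟩⟩
  obtain ⟨n, hn, D, hD, ⟨e⟩⟩ := IsSimpleRing.exists_ringEquiv_matrix_divisionRing A
  have hn0 : n ≠ 0 := hn.out
  by_cases hn1 : n = 1
  · left
    refine ⟨hnt, fun a ha => ?_⟩
    subst hn1
    let f : A ≃+* D := e.trans (Matrix.uniqueRingEquiv (m := Fin 1) (A := D))
    have hfa : f a ≠ 0 := by simpa using ha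
    have := (IsUnit.mk0 _ hfa).map f.symm
    simpa using this
  by_cases hn2 : n = 2
  · right
    subst hn2
    exact ⟨D, hD, ⟨e⟩⟩
  exfalso
  let i0 : Fin n := ⟨0, by omega⟩
  let i1 : Fin n := ⟨1, by omega⟩
  let i2 : Fin n := ⟨2, by omega⟩
  have h01 : i0 ≠ i1 := by simp [i0, i1]
  have h02 : i0 ≠ i2 := by simp [i0, i2]
  have h12 : i1 ≠ i2 := by simp [i1, i2]
  let C : Set (Fin n) → Submodule A A := fun s =>
    { carrier := {x | ∀ i ∈ s, ∀ j, e x j i = 0}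
      add_mem' := by
        intro x y hx hy i hi j
        simp [hx i hi j, hy i hi j]
      zero_mem' := by intro i hi j; simp
      smul_mem' := by
        intro c x hx i hi j
        simp only [smul_eq_mul, map_mul, Matrix.mul_apply]
        exact Finset.sum_eq_zero fun k _ => by rw [hx i hi k, mul_zero] }
  have memC : ∀ s x, x ∈ C s ↔ ∀ i ∈ s, ∀ j, e x j i = 0 := fun s x => Iff.rfl
  have hE : ∀ (s : Set (Fin n)) (k : Fin n), e.symm (Matrix.single k k 1) ∈ C s ↔ k ∉ s := by
    intro s k
    rw [memC]
    constructor
    · intro h hk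
      have := h k hk k
      simp at this
    · intro hk i hi j
      have : k ≠ i := fun h => hk (h ▸ hi)
      simp [Matrix.single_apply, this]
  have key := hc (C {i1, i2}) (C {i2}) ?_ ?_ ?_
  · have h1 := (hE {i2} i1).2 (by simpa using h12)
    rw [← key, hE] at h1
    simp at h1
  · intro h
    have h1 := (hE {i1, i2} i0).2 (by simp [h01, h02])
    rw [h, Submodule.mem_bot] at h1
    have h3 : (Matrix.single i0 i0 (1 : D)) = 0 := by simpa using h1
    have := congrFun (congrFun h3 i0) i0
    simp at this
  · intro x hx i hi j
    exact hx i (Or.inr hi) j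
  · intro h
    have h1 : e.symm (Matrix.single i2 i2 1) ∈ C {i2} := by rw [h]; trivial
    rw [hE] at h1
    simp at h1
end

section
/- Let J be a unital Jordan algebra over a field F of characteristic different from 2 and 3, and let d be a derivation with invertible values of J. Then every proper ideal I of J satisfies d(I) = 0, i.e., I ⊆ ker d. -/
/-- From Kaygorodov–Lopatin–Popov: Jordan algebras admitting derivations with invertible values. -/
theorem jordan_der_inv_values_proper_ideal_in_ker2 (F : Type*) [Field F] (h2 : (2 : F) ≠ 0) (h3 : (3 : F) ≠ 0)
    (J : Type*) [NonAssocRing J] [Module F J] [SMulCommClass F J J] [IsScalarTower F J J]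
    (hcomm : ∀ x y : J, x * y = y * x)
    (hjordan : ∀ x y : J, ((x * x) * y) * x = (x * x) * (y * x))
    (d : J →ₗ[F] J) (hder : ∀ a b : J, d (a * b) = d a * b + a * d b)
    (hd0 : d ≠ 0)
    (hdinv : ∀ x : J, d x = 0 ∨ ∃ y : J, d x * y = 1 ∧ (d x * d x) * y = d x)
    (I : Submodule F J) (hideal : ∀ x ∈ I, ∀ j : J, j * x ∈ I) (hproper : I ≠ ⊤) :
    ∀ x ∈ I, d x = 0 := by
  intro x hx
  have hone : (1 : J) ∉ I := fun h => hproper (by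
    rw [eq_top_iff]
    intro j _
    simpa using hideal 1 h j)
  -- a value of `d` lying in `I` vanishes
  have key : ∀ z : J, d z ∈ I → d z = 0 := by
    intro z hz
    rcases hdinv z with h | ⟨y, hy, -⟩
    · exact h
    · exact absurd (by rw [← hy, hcomm]; exact hideal _ hz y) hone
  have h1 : d (x * x) = 0 := by
    apply key
    rw [hder]
    exact I.add_mem (hideal x hx _) (by rw [hcomm]; exact hideal x hx _)
  -- differentiating twice puts the square of `d x` in `I`
  have h4 : d (d (x * x)) = 0 := by rw [h1, map_zero]
  rw [hder, map_add, hder, hder, hcomm x (d (d x))] at h4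
  have h5 : (2 : F) • (d x * d x) = -((2 : F) • (d (d x) * x)) := by
    rw [two_smul, two_smul, eq_neg_iff_add_eq_zero, ← h4]
    abel
  have h6 : d x * d x ∈ I := by
    rw [← I.smul_mem_iff h2, h5]
    exact I.neg_mem (I.smul_mem _ (hideal x hx _))
  rcases hdinv x with h | ⟨y, -, hy2⟩
  · exact h
  · apply key
    rw [← hy2, hcomm]
    exact hideal _ h6 y
end
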